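/- (Upper bound on the Euclidean length of geodesics.) Let μ be a probability measure on ℝ^d, F ⊂ ℝ^d a closed nonempty set, x, y ∈ ℝ^d, and let γ ∈ Γ_F(x,y) be a geodesic, i.e. D_μ(γ) = D_{μ,F}(x,y). Then |γ| ≤ λ · sup_{t ∈ [0,1]} d_μ(γ(t)), where λ = 2c·ρ^{β+1}/(ρ − 1) with c = (16·5^β + 1152·165^β)/m^{2+β} and ρ = 1 + 32/m. -/

import Mathlib

open MeasureTheory Metric Set ProbabilityTheory
open scoped ENNReal NNReal

noncomputable section

/-- Euclidean space `ℝ^d`. -/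
abbrev Euc (d : ℕ) := EuclideanSpace ℝ (Fin d)

/-- The pseudo-distance-to-measure `δ_{μ,u}(x) = inf {r > 0 : μ(B(x,r)) > u}`. -/
def pseudoDTM {d : ℕ} (μ : Measure (Euc d)) (u : ℝ) (x : Euc d) : ℝ :=
  sInf {r : ℝ | 0 < r ∧ u < (μ (ball x r)).toReal}

/-- The distance-to-measure `d_μ(x) = ((1/m) ∫₀^m δ_{μ,u}(x)^p du)^{1/p}`. -/
def dtm {d : ℕ} (m p : ℝ) (μ : Measure (Euc d)) (x : Euc d) : ℝ :=
  ((1 / m) * ∫ u in Ioc (0 : ℝ) m, pseudoDTM μ u x ^ p) ^ (1 / p)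

/-- A Lipschitz path. -/
def IsLipschitzPath {d : ℕ} (γ : ℝ → Euc d) : Prop := ∃ K, LipschitzWith K γ

/-- Euclidean length `|γ| = ∫₀¹ ‖γ'(t)‖ dt`. -/
def eucLength {d : ℕ} (γ : ℝ → Euc d) : ℝ := ∫ t in Icc (0 : ℝ) 1, ‖deriv γ t‖

/-- FDTM length `D_μ(γ) = ∫₀¹ d_μ(γ(t))^β ‖γ'(t)‖ dt`. -/
def fdtmLength {d : ℕ} (m p β : ℝ) (μ : Measure (Euc d)) (γ : ℝ → Euc d) : ℝ :=
  ∫ t in Icc (0 : ℝ) 1, dtm m p μ (γ t) ^ β * ‖deriv γ t‖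

/-- Admissible paths `Γ_F(x,y)`: Lipschitz paths from `x` to `y` which may leave the domain `F`
only along straight lines. -/
def AdmissiblePath {d : ℕ} (F : Set (Euc d)) (x y : Euc d) (γ : ℝ → Euc d) : Prop :=
  IsLipschitzPath γ ∧ γ 0 = x ∧ γ 1 = y ∧
    ∀ a b : ℝ, 0 ≤ a → b ≤ 1 →
      (∀ t ∈ Ioo a b, γ t ∉ F) →
      ∃ u : Euc d, ‖u‖ = 1 ∧
        ∀ᵐ t ∂(volume.restrict (Ioo a b)), deriv γ t = ‖deriv γ t‖ • u

/-- The Fermat distance-to-measure `D_{μ,F}(x,y) = inf_{γ ∈ Γ_F(x,y)} D_μ(γ)`. -/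
def fdtm {d : ℕ} (m p β : ℝ) (μ : Measure (Euc d)) (F : Set (Euc d)) (x y : Euc d) : ℝ :=
  sInf {L : ℝ | ∃ γ : ℝ → Euc d, AdmissiblePath F x y γ ∧ L = fdtmLength m p β μ γ}

/-- A geodesic: an admissible path realizing the FDTM. -/
def IsGeodesic {d : ℕ} (m p β : ℝ) (μ : Measure (Euc d)) (F : Set (Euc d)) (x y : Euc d)
    (γ : ℝ → Euc d) : Prop :=
  AdmissiblePath F x y γ ∧ fdtmLength m p β μ γ = fdtm m p β μ F x y

/-- FDTM length of the straight segment `[x,y]`. -/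
def segFDTM {d : ℕ} (m p β : ℝ) (μ : Measure (Euc d)) (x y : Euc d) : ℝ :=
  ‖x - y‖ * ∫ t in Icc (0 : ℝ) 1, dtm m p μ ((1 - t) • x + t • y) ^ β

/-- The explicit constant `λ = 2·c·ρ^{β+1}/(ρ−1)` with `c = (16·5^β + 1152·165^β)/m^{2+β}`
and `ρ = 1 + 32/m`. -/
def fdtmConst (m β : ℝ) : ℝ :=
  2 * ((16 * (5 : ℝ) ^ β + 1152 * (165 : ℝ) ^ β) / m ^ (2 + β)) * (1 + 32 / m) ^ (β + 1) /
    ((1 + 32 / m) - 1)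

/-- Support of a measure: points all of whose neighborhoods have positive mass. -/
def measSupport {d : ℕ} (μ : Measure (Euc d)) : Set (Euc d) :=
  {x | ∀ r : ℝ, 0 < r → 0 < μ (ball x r)}

/-- `(a,b)`-standard measure: `μ(B(x,r)) ≥ a·r^b` for `x ∈ supp(μ)` and `0 < r ≤ a^{-1/b}`. -/
def IsStandard {d : ℕ} (μ : Measure (Euc d)) (a b : ℝ) : Prop :=
  ∀ x ∈ measSupport μ, ∀ r : ℝ, 0 < r → r ≤ a ^ (-(1 / b)) → a * r ^ b ≤ (μ (ball x r)).toReal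

section PseudoDTM

variable {d : ℕ} (μ : Measure (Euc d))

lemma bddBelow_pseudoDTM_set {u : ℝ} {x : Euc d} :
    BddBelow {r : ℝ | 0 < r ∧ u < (μ (ball x r)).toReal} :=
  ⟨0, fun _ hr => hr.1.le⟩

lemma pseudoDTM_nonneg (u : ℝ) (x : Euc d) : 0 ≤ pseudoDTM μ u x :=
  Real.sInf_nonneg fun _ hr => hr.1.le

variable [IsProbabilityMeasure μ]

lemma nonempty_pseudoDTM_set {u : ℝ} (hu : u < 1) (x : Euc d) :
    {r : ℝ | 0 < r ∧ u < (μ (ball x r)).toReal}.Nonempty := by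
  have h1 : Filter.Tendsto (fun n : ℕ => μ (ball x n)) Filter.atTop (nhds (μ (⋃ n : ℕ, ball x n))) :=
    tendsto_measure_iUnion_atTop fun i j hij => ball_subset_ball (by exact_mod_cast hij)
  rw [iUnion_ball_nat, measure_univ] at h1
  have h2 := (ENNReal.tendsto_toReal ENNReal.one_ne_top).comp h1
  rw [ENNReal.toReal_one] at h2
  obtain ⟨n, hn, hn0⟩ := ((h2.eventually (lt_mem_nhds hu)).and
    (Filter.eventually_gt_atTop 0)).exists
  exact ⟨n, by exact_mod_cast hn0, hn⟩

lemma pseudoDTM_le_add_dist {u : ℝ} (hu : u < 1) (x y : Euc d) :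
    pseudoDTM μ u x ≤ pseudoDTM μ u y + dist x y := by
  rw [← sub_le_iff_le_add]
  refine le_csInf (nonempty_pseudoDTM_set μ hu y) fun r hr => ?_
  rw [sub_le_iff_le_add]
  refine csInf_le (bddBelow_pseudoDTM_set μ) ⟨by linarith [hr.1, dist_nonneg (x := x) (y := y)], ?_⟩
  refine hr.2.trans_le (ENNReal.toReal_mono (measure_ne_top _ _) (measure_mono ?_))
  exact ball_subset_ball' (by rw [dist_comm])

lemma pseudoDTM_mono {u v : ℝ} (huv : u ≤ v) (hv : v < 1) (x : Euc d) :
    pseudoDTM μ u x ≤ pseudoDTM μ v x :=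
  csInf_le_csInf (bddBelow_pseudoDTM_set μ) (nonempty_pseudoDTM_set μ hv x)
    fun _ hr => ⟨hr.1, huv.trans_lt hr.2⟩

lemma le_pseudoDTM {u r : ℝ} (hu : u < 1) {x : Euc d} (h : (μ (ball x r)).toReal ≤ u) :
    r ≤ pseudoDTM μ u x := by
  refine le_csInf (nonempty_pseudoDTM_set μ hu x) fun s hs => ?_
  by_contra! hlt
  have := ENNReal.toReal_mono (measure_ne_top μ _) (measure_mono (ball_subset_ball (x := x) hlt.le))
  linarith [hs.2]

lemma memLp_pseudoDTM {m : ℝ} (hm : m < 1) (p : ℝ≥0∞) (x : Euc d) :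
    MemLp (fun u => pseudoDTM μ u x) p (volume.restrict (Ioc 0 m)) := by
  refine MemLp.of_bound (C := pseudoDTM μ m x) ?_ ?_
  · refine (aemeasurable_restrict_of_monotoneOn measurableSet_Ioc
      fun u hu v hv huv => ?_).aestronglyMeasurable
    exact pseudoDTM_mono μ huv (hv.2.trans_lt hm) x
  · filter_upwards [ae_restrict_mem measurableSet_Ioc] with u hu
    rw [Real.norm_of_nonneg (pseudoDTM_nonneg μ u x)]
    exact pseudoDTM_mono μ hu.2 hm x

end PseudoDTM

section DTM

variable {d : ℕ} {m p : ℝ} (μ : Measure (Euc d))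

lemma dtm_integral_nonneg (hm : m ∈ Set.Ioo (0 : ℝ) 1) (x : Euc d) :
    0 ≤ (1 / m) * ∫ u in Ioc (0 : ℝ) m, pseudoDTM μ u x ^ p :=
  mul_nonneg (one_div_nonneg.2 hm.1.le)
    (integral_nonneg fun u => Real.rpow_nonneg (pseudoDTM_nonneg μ u x) p)

lemma dtm_nonneg (hm : m ∈ Set.Ioo (0 : ℝ) 1) (x : Euc d) : 0 ≤ dtm m p μ x :=
  Real.rpow_nonneg (dtm_integral_nonneg μ hm x) _

lemma dtm_rpow (hm : m ∈ Set.Ioo (0 : ℝ) 1) (hp : 1 ≤ p) (x : Euc d) :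
    dtm m p μ x ^ p = (1 / m) * ∫ u in Ioc (0 : ℝ) m, pseudoDTM μ u x ^ p := by
  rw [dtm, one_div p, Real.rpow_inv_rpow (dtm_integral_nonneg μ hm x) (by positivity)]

variable [IsProbabilityMeasure μ]

lemma ofReal_dtm (hm : m ∈ Set.Ioo (0 : ℝ) 1) (hp : 1 ≤ p) (x : Euc d) :
    ENNReal.ofReal (dtm m p μ x) = eLpNorm (fun u => pseudoDTM μ u x) (ENNReal.ofReal p)
      (ENNReal.ofReal (1 / m) • volume.restrict (Ioc (0 : ℝ) m)) := by
  have hp0 : 0 < p := by positivity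
  have hL := (memLp_pseudoDTM μ hm.2 (ENNReal.ofReal p) x).smul_measure
    (c := ENNReal.ofReal (1 / m)) ENNReal.ofReal_ne_top
  rw [hL.eLpNorm_eq_integral_rpow_norm (by simpa using hp0) ENNReal.ofReal_ne_top,
    ENNReal.toReal_ofReal hp0.le, integral_smul_measure,
    ENNReal.toReal_ofReal (one_div_nonneg.2 hm.1.le), dtm, one_div p]
  simp_rw [Real.norm_of_nonneg (pseudoDTM_nonneg μ _ x)]
  rfl

lemma dtm_le_add_dist (hm : m ∈ Set.Ioo (0 : ℝ) 1) (hp : 1 ≤ p) (x y : Euc d) :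
    dtm m p μ x ≤ dtm m p μ y + dist x y := by
  have hp0 : 0 < p := by positivity
  rw [← ENNReal.ofReal_le_ofReal_iff (add_nonneg (dtm_nonneg μ hm y) dist_nonneg),
    ENNReal.ofReal_add (dtm_nonneg μ hm y) dist_nonneg, ofReal_dtm μ hm hp, ofReal_dtm μ hm hp]
  set ν := ENNReal.ofReal (1 / m) • volume.restrict (Ioc (0 : ℝ) m) with hν
  have hν1 : ν univ = 1 := by
    rw [hν, Measure.smul_apply, Measure.restrict_apply_univ, Real.volume_Ioc, smul_eq_mul,
      ← ENNReal.ofReal_mul (one_div_nonneg.2 hm.1.le), sub_zero, one_div_mul_cancel hm.1.ne',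
      ENNReal.ofReal_one]
  have hc : eLpNorm (fun _ : ℝ => dist x y) (ENNReal.ofReal p) ν = ENNReal.ofReal (dist x y) := by
    rw [eLpNorm_const' _ (by simpa using hp0) ENNReal.ofReal_ne_top, hν1, ENNReal.one_rpow, mul_one,
      Real.enorm_of_nonneg dist_nonneg]
  rw [← hc]
  refine le_trans ?_ (eLpNorm_add_le ?_ aestronglyMeasurable_const (by simpa using hp))
  · refine eLpNorm_mono_ae_real ?_
    refine Measure.ae_smul_measure ?_ _
    filter_upwards [ae_restrict_mem measurableSet_Ioc] with u hu
    rw [Real.norm_of_nonneg (pseudoDTM_nonneg μ u x)]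
    exact pseudoDTM_le_add_dist μ (hu.2.trans_lt hm.2) x y
  · exact ((memLp_pseudoDTM μ hm.2 (ENNReal.ofReal p) y).smul_measure
      (c := ENNReal.ofReal (1 / m)) ENNReal.ofReal_ne_top).1

lemma lipschitzWith_dtm (hm : m ∈ Set.Ioo (0 : ℝ) 1) (hp : 1 ≤ p) :
    LipschitzWith 1 (dtm m p μ) :=
  LipschitzWith.of_le_add fun x y => dtm_le_add_dist μ hm hp x y

/-- A ball whose radius is a multiple of the distance-to-measure at its center is heavy. -/
lemma half_le_measure_ball (hm : m ∈ Set.Ioo (0 : ℝ) 1) (hp : 1 ≤ p) {x : Euc d} {ρ : ℝ}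
    (hρ : 0 < ρ) (hx : dtm m p μ x ≤ ρ) : m / 2 ≤ (μ (ball x (3 * ρ))).toReal := by
  by_contra! hlt
  have hm0 := hm.1
  have hp0 : 0 < p := by positivity
  have hintegrable : IntegrableOn (fun u => pseudoDTM μ u x ^ p) (Ioc (0 : ℝ) m) := by
    have := (memLp_pseudoDTM μ hm.2 (ENNReal.ofReal p) x).integrable_norm_rpow
      (by simpa using hp0) ENNReal.ofReal_ne_top
    simp only [Real.norm_of_nonneg (pseudoDTM_nonneg μ _ x), ENNReal.toReal_ofReal hp0.le] at this
    exact this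
  have h1 : ∫ _ in Ioc (m / 2) m, (3 * ρ) ^ p ≤ ∫ u in Ioc (0 : ℝ) m, pseudoDTM μ u x ^ p := by
    refine le_trans (setIntegral_mono_on (by simp) (hintegrable.mono_set ?_) measurableSet_Ioc ?_)
      (setIntegral_mono_set hintegrable ?_ ?_)
    · exact Ioc_subset_Ioc_left (by positivity)
    · intro u hu
      exact Real.rpow_le_rpow (by positivity)
        (le_pseudoDTM μ (hu.2.trans_lt hm.2) (hlt.le.trans hu.1.le)) hp0.le
    · exact Filter.Eventually.of_forall fun u => Real.rpow_nonneg (pseudoDTM_nonneg μ u x) p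
    · exact (Ioc_subset_Ioc_left (by positivity)).eventuallyLE
  rw [setIntegral_const, Real.volume_real_Ioc_of_le (by linarith), smul_eq_mul,
    Real.mul_rpow (by norm_num) hρ.le] at h1
  have h2 : dtm m p μ x ^ p ≤ ρ ^ p := Real.rpow_le_rpow (dtm_nonneg μ hm x) hx hp0.le
  rw [dtm_rpow μ hm hp] at h2
  have h3 : (3 : ℝ) ≤ 3 ^ p := by
    simpa using Real.rpow_le_rpow_of_exponent_le (x := 3) (by norm_num) hp
  have h4 : (0 : ℝ) < ρ ^ p := by positivity
  rw [one_div, inv_mul_le_iff₀ hm0] at h2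
  nlinarith [mul_le_mul_of_nonneg_right h3 (mul_pos hm0 h4).le, mul_pos hm0 h4]

lemma finite_setOf_dtm_eq_zero (hm : m ∈ Set.Ioo (0 : ℝ) 1) (hp : 1 ≤ p) :
    {x | dtm m p μ x = 0}.Finite := by
  have hm0 := hm.1
  have hfin := Measure.finite_const_le_meas_of_disjoint_iUnion μ
    (ε := ENNReal.ofReal (m / 2)) (by simpa using hm0) (As := fun x : Euc d => {x})
    (fun x => measurableSet_singleton x)
    (fun x y hxy => by simpa [Function.onFun] using hxy) (measure_ne_top _ _)
  refine hfin.subset fun x hx => ?_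
  by_contra! hlt
  simp only [mem_ofPred_eq, not_le] at hlt hx
  obtain ⟨U, hU, hUo, hUlt⟩ := Set.exists_isOpen_lt_of_lt _ _ hlt
  obtain ⟨ε, hε, hball⟩ := Metric.isOpen_iff.1 hUo x (hU rfl)
  have h1 := half_le_measure_ball μ hm hp (x := x) (ρ := ε / 3) (by positivity)
    (by rw [hx]; positivity)
  rw [mul_div_cancel₀ _ (by norm_num)] at h1
  have h2 : ENNReal.ofReal (m / 2) ≤ μ (ball x ε) := ENNReal.ofReal_le_of_le_toReal h1
  exact absurd (h2.trans (measure_mono hball)) hUlt.not_ge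

/-- Sublevel sets of the distance-to-measure are covered by few balls. -/
lemma exists_cover_dtm_le (hm : m ∈ Set.Ioo (0 : ℝ) 1) (hp : 1 ≤ p) {ρ : ℝ} (hρ : 0 < ρ) :
    ∃ C : Finset (Euc d), (C.card : ℝ) ≤ 2 / m ∧
      ∀ x, dtm m p μ x ≤ ρ → ∃ c ∈ C, dist x c ≤ 6 * ρ := by
  classical
  have hm0 := hm.1
  let P : Finset (Euc d) → Prop := fun C =>
    (∀ x ∈ C, dtm m p μ x ≤ ρ) ∧ (C : Set (Euc d)).Pairwise fun x y => 6 * ρ < dist x y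
  have hcard : ∀ C, P C → (C.card : ℝ) ≤ 2 / m := by
    intro C hC
    have hdisj : (C : Set (Euc d)).PairwiseDisjoint fun x => ball x (3 * ρ) := by
      intro x hx y hy hxy
      exact ball_disjoint_ball (by linarith [hC.2 hx hy hxy])
    have h1 : ∑ x ∈ C, (μ (ball x (3 * ρ))).toReal ≤ 1 := by
      have := measureReal_biUnion_finset (μ := μ) hdisj fun x _ => measurableSet_ball
      simp only [Measure.real] at this
      rw [← this]
      exact measureReal_le_one
    have h2 := Finset.card_nsmul_le_sum C (fun x => (μ (ball x (3 * ρ))).toReal) (m / 2)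
      fun x hx => half_le_measure_ball μ hm hp hρ (hC.1 x hx)
    rw [nsmul_eq_mul] at h2
    rw [le_div_iff₀ hm0]
    linarith
  have hbdd : ∃ n : ℕ, ∀ C, P C → C.card ≤ n :=
    ⟨⌊2 / m⌋₊, fun C hC => Nat.le_floor (hcard C hC)⟩
  obtain ⟨n, hn⟩ := hbdd
  let Q : ℕ → Prop := fun k => ∃ C, P C ∧ C.card = k
  obtain ⟨C, hC, hCc⟩ : Q (Nat.findGreatest Q n) :=
    Nat.findGreatest_spec (Nat.zero_le n) ⟨∅, by simp [P], rfl⟩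
  refine ⟨C, hcard C hC, fun x hx => ?_⟩
  by_contra! hfar
  have hxC : x ∉ C := fun h => by
    have := hfar x h
    rw [dist_self] at this
    linarith
  have hP : P (insert x C) := by
    refine ⟨fun y hy => ?_, ?_⟩
    · rcases Finset.mem_insert.1 hy with rfl | hy
      exacts [hx, hC.1 y hy]
    · rw [Finset.coe_insert]
      refine hC.2.insert fun y hy _ => ⟨hfar y hy, ?_⟩
      rw [dist_comm]
      exact hfar y hy
  have h1 : (insert x C).card ≤ Nat.findGreatest Q n :=
    Nat.le_findGreatest (hn _ hP) ⟨_, hP, rfl⟩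
  rw [Finset.card_insert_of_notMem hxC, hCc] at h1
  omega

end DTM

section Path

variable {d : ℕ}

/-- The length measure of a path on the time interval `[0,1]`. -/
def pathLen (γ : ℝ → Euc d) : Measure ℝ :=
  (volume.restrict (Icc 0 1)).withDensity fun t => ENNReal.ofReal ‖deriv γ t‖

/-- The length measure of a path on the time interval `[0,1]`, weighted by `w ^ β`. -/
def pathCost (w : Euc d → ℝ) (β : ℝ) (γ : ℝ → Euc d) : Measure ℝ :=
  (volume.restrict (Icc 0 1)).withDensity fun t => ENNReal.ofReal (w (γ t) ^ β * ‖deriv γ t‖)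

/-- The path `γ` moves in a constant direction during `(a,b)`. -/
def IsStraightOn (γ : ℝ → Euc d) (a b : ℝ) : Prop :=
  ∃ u : Euc d, ‖u‖ = 1 ∧ ∀ᵐ t ∂(volume.restrict (Ioo a b)), deriv γ t = ‖deriv γ t‖ • u

variable {γ : ℝ → Euc d} {K : ℝ≥0}

lemma integrableOn_norm_deriv (hγ : LipschitzWith K γ) (a b : ℝ) :
    IntegrableOn (fun t => ‖deriv γ t‖) (Icc a b) := by
  refine Measure.integrableOn_of_bounded (M := K) (by simp)
    (measurable_deriv γ).norm.aestronglyMeasurable ?_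
  filter_upwards with t
  rw [norm_norm]
  exact norm_deriv_le_of_lipschitz hγ

lemma intervalIntegrable_norm_deriv (hγ : LipschitzWith K γ) {a b : ℝ} (hab : a ≤ b) :
    IntervalIntegrable (fun t => ‖deriv γ t‖) volume a b := by
  rw [intervalIntegrable_iff_integrableOn_Icc_of_le hab]
  exact integrableOn_norm_deriv hγ a b

lemma ofReal_eucLength (hγ : LipschitzWith K γ) :
    ENNReal.ofReal (eucLength γ) = pathLen γ (Icc 0 1) := by
  rw [pathLen, withDensity_apply _ measurableSet_Icc, Measure.restrict_restrict measurableSet_Icc,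
    inter_self, eucLength, ofReal_integral_eq_lintegral_ofReal (integrableOn_norm_deriv hγ 0 1)
      (Filter.Eventually.of_forall fun t => norm_nonneg _)]

lemma pathLen_Icc (hγ : LipschitzWith K γ) {a b : ℝ} (ha : 0 ≤ a) (hab : a ≤ b) (hb : b ≤ 1) :
    pathLen γ (Icc a b) = ENNReal.ofReal (∫ t in a..b, ‖deriv γ t‖) := by
  rw [pathLen, withDensity_apply _ measurableSet_Icc, Measure.restrict_restrict measurableSet_Icc,
    inter_eq_self_of_subset_left (Icc_subset_Icc ha hb), intervalIntegral.integral_of_le hab,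
    ← integral_Icc_eq_integral_Ioc,
    ofReal_integral_eq_lintegral_ofReal (integrableOn_norm_deriv hγ a b)
      (Filter.Eventually.of_forall fun t => norm_nonneg _)]

instance : NullSingletonClass (pathLen γ) := by
  unfold pathLen; infer_instance

lemma ae_inner_deriv (hγ : LipschitzWith K γ) (e : Euc d) :
    ∀ᵐ t : ℝ, deriv (fun s => inner ℝ e (γ s)) t = inner ℝ e (deriv γ t) := by
  filter_upwards [hγ.ae_differentiableAt_real] with t ht
  exact ((hasDerivAt_const t e).inner ℝ ht.hasDerivAt).deriv.trans (by simp)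

lemma integral_inner_deriv (hγ : LipschitzWith K γ) (e : Euc d) (a b : ℝ) :
    ∫ t in a..b, inner ℝ e (deriv γ t) = inner ℝ e (γ b - γ a) := by
  have hlip : LipschitzWith (‖innerSL ℝ e‖₊ * K) fun s => inner ℝ e (γ s) :=
    (innerSL ℝ e).lipschitz.comp hγ
  have h := (hlip.lipschitzOnWith (s := uIcc a b)).absolutelyContinuousOnInterval.integral_deriv_eq_sub
  rw [inner_sub_right, ← h]
  refine intervalIntegral.integral_congr_ae ?_
  filter_upwards [ae_inner_deriv hγ e] with t ht _
  exact ht.symm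

lemma dist_le_integral (hγ : LipschitzWith K γ) {a b : ℝ} (hab : a ≤ b) :
    dist (γ a) (γ b) ≤ ∫ t in a..b, ‖deriv γ t‖ := by
  rcases eq_or_ne (γ b - γ a) 0 with h0 | h0
  · rw [sub_eq_zero.1 h0, dist_self]
    exact intervalIntegral.integral_nonneg hab fun t _ => norm_nonneg _
  set e : Euc d := ‖γ b - γ a‖⁻¹ • (γ b - γ a) with he
  have he1 : ‖e‖ = 1 := norm_smul_inv_norm (𝕜 := ℝ) h0
  have h1 : inner ℝ e (γ b - γ a) = dist (γ a) (γ b) := by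
    rw [he, real_inner_smul_left, real_inner_self_eq_norm_sq, dist_comm, dist_eq_norm]
    field_simp
  rw [← h1, ← integral_inner_deriv hγ]
  have hle : ∀ t, ‖inner ℝ e (deriv γ t)‖ ≤ ‖deriv γ t‖ := fun t => by
    simpa [he1] using norm_inner_le_norm (𝕜 := ℝ) e (deriv γ t)
  refine intervalIntegral.integral_mono_on hab ?_ (intervalIntegrable_norm_deriv hγ hab)
    fun t _ => (Real.le_norm_self _).trans (hle t)
  refine (intervalIntegrable_norm_deriv hγ hab).mono_fun' ?_ (Filter.Eventually.of_forall hle)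
  exact ((measurable_const.inner (measurable_deriv γ)).aestronglyMeasurable)

lemma dist_le_pathLen (hγ : LipschitzWith K γ) {a b s t : ℝ} (ha : 0 ≤ a) (hb : b ≤ 1)
    (hs : s ∈ Icc a b) (ht : t ∈ Icc a b) :
    ENNReal.ofReal (dist (γ s) (γ t)) ≤ pathLen γ (Ioo a b) := by
  wlog hst : s ≤ t generalizing s t
  · rw [dist_comm]
    exact this ht hs (le_of_not_ge hst)
  rw [Ioo_ae_eq_Icc.measure_eq]
  calc ENNReal.ofReal (dist (γ s) (γ t))
      ≤ pathLen γ (Icc s t) := by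
        rw [pathLen_Icc hγ (ha.trans hs.1) hst (ht.2.trans hb)]
        exact ENNReal.ofReal_le_ofReal (dist_le_integral hγ hst)
    _ ≤ pathLen γ (Icc a b) := measure_mono (Icc_subset_Icc hs.1 ht.2)

lemma IsStraightOn.pathLen_Icc_le {a b s t : ℝ} (h : IsStraightOn γ a b) (hγ : LipschitzWith K γ)
    (ha : 0 ≤ a) (hb : b ≤ 1) (hs : a ≤ s) (hst : s ≤ t) (ht : t ≤ b) :
    pathLen γ (Icc s t) ≤ ENNReal.ofReal (dist (γ s) (γ t)) := by
  obtain ⟨u, hu, hd⟩ := h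
  rw [pathLen_Icc hγ (ha.trans hs) hst (ht.trans hb)]
  refine ENNReal.ofReal_le_ofReal ?_
  have h1 : ∫ x in s..t, ‖deriv γ x‖ = ∫ x in s..t, inner ℝ u (deriv γ x) := by
    rw [intervalIntegral.integral_of_le hst, intervalIntegral.integral_of_le hst,
      integral_Ioc_eq_integral_Ioo, integral_Ioc_eq_integral_Ioo]
    refine integral_congr_ae ?_
    filter_upwards [ae_restrict_of_ae_restrict_of_subset (Ioo_subset_Ioo hs ht) hd] with x hx
    conv_rhs => rw [hx, real_inner_smul_right, real_inner_self_eq_norm_sq, hu]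
    simp
  rw [h1, integral_inner_deriv hγ, dist_comm, dist_eq_norm]
  simpa [hu] using real_inner_le_norm u (γ t - γ s)

lemma IsStraightOn.pathLen_le {a b D : ℝ} (h : IsStraightOn γ a b) (hγ : LipschitzWith K γ)
    (ha : 0 ≤ a) (hb : b ≤ 1) {S : Set ℝ} (hS : S ⊆ Icc a b)
    (hD : ∀ x ∈ S, ∀ y ∈ S, dist (γ x) (γ y) ≤ D) : pathLen γ S ≤ ENNReal.ofReal D := by
  rcases S.eq_empty_or_nonempty with rfl | hne
  · simp
  have hbb : BddBelow S := bddBelow_Icc.mono hS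
  have hba : BddAbove S := bddAbove_Icc.mono hS
  have hcl : closure S ⊆ Icc a b := closure_minimal hS isClosed_Icc
  have hs := csInf_mem_closure hne hbb
  have ht := csSup_mem_closure hne hba
  have hsub : S ⊆ Icc (sInf S) (sSup S) := fun x hx => ⟨csInf_le hbb hx, le_csSup hba hx⟩
  refine (measure_mono hsub).trans ((h.pathLen_Icc_le hγ ha hb (hcl hs).1
    (csInf_le_csSup hne hbb hba) (hcl ht).2).trans (ENNReal.ofReal_le_ofReal ?_))
  have hmem : (sInf S, sSup S) ∈ closure (S ×ˢ S) := by
    rw [closure_prod_eq]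
    exact ⟨hs, ht⟩
  have hclosed : IsClosed {z : ℝ × ℝ | dist (γ z.1) (γ z.2) ≤ D} :=
    isClosed_le ((hγ.continuous.comp continuous_fst).dist (hγ.continuous.comp continuous_snd))
      continuous_const
  have hprod : S ×ˢ S ⊆ {z : ℝ × ℝ | dist (γ z.1) (γ z.2) ≤ D} := fun z hz =>
    hD z.1 hz.1 z.2 hz.2
  have hfinal := closure_minimal hprod hclosed hmem
  rwa [mem_ofPred_eq] at hfinal

/-- A straight piece of path spends little length in a set covered by few small balls. -/
lemma IsStraightOn.pathLen_le_of_cover {a b R N : ℝ} (h : IsStraightOn γ a b)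
    (hγ : LipschitzWith K γ) (ha : 0 ≤ a) (hb : b ≤ 1) (hR : 0 ≤ R) {C : Finset (Euc d)}
    (hC : (C.card : ℝ) ≤ N) {S : Set ℝ} (hS : S ⊆ Icc a b)
    (hcov : ∀ t ∈ S, ∃ c ∈ C, dist (γ t) c ≤ R) :
    pathLen γ S ≤ ENNReal.ofReal (N * (2 * R)) := by
  have hsub : S ⊆ ⋃ c ∈ C, {t ∈ S | dist (γ t) c ≤ R} := fun t ht => by
    obtain ⟨c, hc, htc⟩ := hcov t ht
    exact mem_iUnion₂.2 ⟨c, hc, ht, htc⟩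
  calc pathLen γ S ≤ ∑ c ∈ C, pathLen γ {t ∈ S | dist (γ t) c ≤ R} :=
        (measure_mono hsub).trans (measure_biUnion_finset_le _ _)
    _ ≤ ∑ c ∈ C, ENNReal.ofReal (2 * R) := by
        refine Finset.sum_le_sum fun c _ => h.pathLen_le hγ ha hb (fun t ht => hS ht.1) ?_
        intro x hx y hy
        linarith [dist_triangle_right (γ x) (γ y) c, hx.2, hy.2]
    _ = ENNReal.ofReal (C.card * (2 * R)) := by
        rw [Finset.sum_const, nsmul_eq_mul, ENNReal.ofReal_mul (Nat.cast_nonneg _),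
          ENNReal.ofReal_natCast]
    _ ≤ ENNReal.ofReal (N * (2 * R)) := by gcongr

/-- A path has zero length over the times at which it sits in a finite set. -/
lemma pathLen_preimage_finite (hγ : LipschitzWith K γ) {Z : Set (Euc d)} (hZ : Z.Finite) :
    pathLen γ (γ ⁻¹' Z) = 0 := by
  rw [← biUnion_of_singleton Z, preimage_iUnion₂]
  refine (measure_biUnion_null_iff hZ.countable).2 fun z _ => ?_
  set S := γ ⁻¹' {z} with hS
  have hSm : MeasurableSet S := (isClosed_singleton.preimage hγ.continuous).measurableSet
  rw [pathLen, withDensity_apply _ hSm, Measure.restrict_restrict hSm]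
  refine (lintegral_congr_ae ?_).trans lintegral_zero
  refine (ae_restrict_iff' (hSm.inter measurableSet_Icc)).2 ?_
  have hcount := (countable_setOfPred_isolated_right_within (s := S)).ae_notMem volume
  filter_upwards [hcount, hγ.ae_differentiableAt_real] with t ht hdiff htS
  have hacc : AccPt t (Filter.principal S) := by
    rw [accPt_principal_iff_nhdsWithin]
    have h1 : (nhdsWithin t (S ∩ Ioi t)).NeBot :=
      ⟨fun hbot => ht ⟨htS.1, hbot⟩⟩
    exact h1.mono (nhdsWithin_mono t fun s hs => ⟨hs.1, ne_of_gt hs.2⟩)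
  have huniq := uniqueDiffWithinAt_iff_accPt.2 hacc
  have h0 : HasDerivWithinAt γ 0 S t :=
    (hasDerivWithinAt_const t S z).congr (fun s hs => hs) htS.1
  have : deriv γ t = 0 := huniq.eq_deriv S hdiff.hasDerivAt.hasDerivWithinAt h0
  simp [this]

variable {w : Euc d → ℝ} {β : ℝ}

lemma mul_pathLen_le_pathCost (hβ : 0 ≤ β) {s : ℝ} (hs : 0 ≤ s) {S : Set ℝ} (hS : MeasurableSet S)
    (h : ∀ t ∈ S, s ≤ w (γ t)) :
    ENNReal.ofReal (s ^ β) * pathLen γ S ≤ pathCost w β γ S := by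
  rw [pathLen, pathCost, withDensity_apply _ hS, withDensity_apply _ hS,
    ← lintegral_const_mul _ (measurable_deriv γ).norm.ennreal_ofReal]
  refine setLIntegral_mono' hS fun t ht => ?_
  rw [← ENNReal.ofReal_mul (Real.rpow_nonneg hs β)]
  gcongr
  exact h t ht

lemma pathCost_le_mul_pathLen (hβ : 0 ≤ β) (hw : ∀ x, 0 ≤ w x) {B : ℝ} {S : Set ℝ}
    (hS : MeasurableSet S) (h : ∀ t ∈ S, w (γ t) ≤ B) :
    pathCost w β γ S ≤ ENNReal.ofReal (B ^ β) * pathLen γ S := by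
  rw [pathLen, pathCost, withDensity_apply _ hS, withDensity_apply _ hS,
    ← lintegral_const_mul _ (measurable_deriv γ).norm.ennreal_ofReal]
  refine setLIntegral_mono' hS fun t ht => ?_
  rw [← ENNReal.ofReal_mul (Real.rpow_nonneg ((hw _).trans (h t ht)) β)]
  gcongr
  exacts [hw _, h t ht]

end Path

section Shortcut

variable {d : ℕ}

/-- The path `γ` with its restriction to `[s,t]` replaced by a straight segment. -/
def shortcut (γ : ℝ → Euc d) (s t τ : ℝ) : Euc d :=
  γ (min τ s) + (max s (min τ t) - s) • ((t - s)⁻¹ • (γ t - γ s)) + (γ (max τ t) - γ t)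

variable {γ : ℝ → Euc d} {s t : ℝ}

lemma shortcut_of_le (hst : s < t) {τ : ℝ} (h : τ ≤ s) : shortcut γ s t τ = γ τ := by
  rw [shortcut, min_eq_left h, min_eq_left (h.trans hst.le), max_eq_left h,
    max_eq_right (h.trans hst.le)]
  simp

lemma shortcut_of_ge (hst : s < t) {τ : ℝ} (h : t ≤ τ) : shortcut γ s t τ = γ τ := by
  rw [shortcut, min_eq_right (hst.le.trans h), min_eq_right h, max_eq_right hst.le,
    max_eq_left h, smul_smul, mul_inv_cancel₀ (sub_pos.2 hst).ne']
  simp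

lemma shortcut_of_mem {τ : ℝ} (h : τ ∈ Icc s t) :
    shortcut γ s t τ = γ s + (τ - s) • ((t - s)⁻¹ • (γ t - γ s)) := by
  rw [shortcut, min_eq_right h.1, min_eq_left h.2, max_eq_right h.1, max_eq_right h.2]
  simp

lemma lipschitzWith_shortcut {K : ℝ≥0} (hγ : LipschitzWith K γ) :
    ∃ K', LipschitzWith K' (shortcut γ s t) := by
  have h1 : LipschitzWith _ fun τ : ℝ => γ (min τ s) :=
    hγ.comp (LipschitzWith.id.min_const s)
  have h2 : LipschitzWith _ fun τ : ℝ => max s (min τ t) - s :=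
    ((LipschitzWith.id.min_const t).const_max s).sub (LipschitzWith.const s)
  have h3 : LipschitzWith _ fun τ : ℝ =>
      (max s (min τ t) - s) • ((t - s)⁻¹ • (γ t - γ s)) :=
    (ContinuousLinearMap.toSpanSingleton ℝ ((t - s)⁻¹ • (γ t - γ s))).lipschitz.comp h2
  have h4 : LipschitzWith _ fun τ : ℝ => γ (max τ t) - γ t :=
    (hγ.comp (LipschitzWith.id.max_const t)).sub (LipschitzWith.const (γ t))
  exact ⟨_, (h1.add h3).add h4⟩

lemma deriv_shortcut_of_notMem (hst : s < t) {τ : ℝ} (h : τ ∉ Icc s t) :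
    deriv (shortcut γ s t) τ = deriv γ τ := by
  refine Filter.EventuallyEq.deriv_eq ?_
  filter_upwards [isClosed_Icc.isOpen_compl.mem_nhds h] with x hx
  rcases lt_or_ge x s with h1 | h1
  · exact shortcut_of_le hst h1.le
  · exact shortcut_of_ge hst (le_of_not_ge fun h2 => hx ⟨h1, h2⟩)

lemma deriv_shortcut_of_mem {τ : ℝ} (h : τ ∈ Ioo s t) :
    deriv (shortcut γ s t) τ = (t - s)⁻¹ • (γ t - γ s) := by
  have h1 : shortcut γ s t =ᶠ[nhds τ]
      fun x => γ s + (x - s) • ((t - s)⁻¹ • (γ t - γ s)) := by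
    filter_upwards [isOpen_Ioo.mem_nhds h] with x hx
    exact shortcut_of_mem (Ioo_subset_Icc_self hx)
  rw [h1.deriv_eq]
  have h2 := (((hasDerivAt_id τ).sub_const s).smul_const ((t - s)⁻¹ • (γ t - γ s))).const_add (γ s)
  simpa using h2.deriv

lemma AdmissiblePath.shortcut {F : Set (Euc d)} {x y : Euc d} (h : AdmissiblePath F x y γ)
    (hs0 : 0 ≤ s) (hst : s < t) (ht1 : t ≤ 1) (hs : γ s ∈ F) (ht : γ t ∈ F) :
    AdmissiblePath F x y (shortcut γ s t) := by
  obtain ⟨⟨K, hK⟩, h0, h1, hF⟩ := h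
  refine ⟨lipschitzWith_shortcut hK, ?_, ?_, fun a b ha hb hab => ?_⟩
  · rw [shortcut_of_le hst hs0, h0]
  · rw [shortcut_of_ge hst ht1, h1]
  obtain ⟨u₀, hu₀, -⟩ := hF 0 0 le_rfl zero_le_one (by simp)
  have hsn : s ∉ Ioo a b := fun hmem => hab s hmem (by rwa [shortcut_of_le hst le_rfl])
  have htn : t ∉ Ioo a b := fun hmem => hab t hmem (by rwa [shortcut_of_ge hst le_rfl])
  have hout : (∀ τ ∈ Ioo a b, τ ∉ Icc s t) → ∃ u : Euc d, ‖u‖ = 1 ∧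
      ∀ᵐ τ ∂(volume.restrict (Ioo a b)),
        deriv (_root_.shortcut γ s t) τ = ‖deriv (_root_.shortcut γ s t) τ‖ • u := by
    intro hdis
    obtain ⟨u, hu, hd⟩ := hF a b ha hb fun τ hτ => by
      have := hab τ hτ
      rcases lt_or_ge τ s with h2 | h2
      · rwa [shortcut_of_le hst h2.le] at this
      · rwa [shortcut_of_ge hst (le_of_not_ge fun h3 => hdis τ hτ ⟨h2, h3⟩)] at this
    refine ⟨u, hu, ?_⟩
    filter_upwards [hd, ae_restrict_mem measurableSet_Ioo] with τ h2 h3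
    rwa [deriv_shortcut_of_notMem hst (hdis τ h3)]
  by_cases hbs : b ≤ s
  · exact hout fun τ hτ hτ' => absurd hτ'.1 (not_le.2 (hτ.2.trans_le hbs))
  by_cases hta : t ≤ a
  · exact hout fun τ hτ hτ' => absurd hτ'.2 (not_le.2 (hta.trans_lt hτ.1))
  push Not at hbs hta
  have hsa : s ≤ a := le_of_not_gt fun h2 => hsn ⟨h2, hbs⟩
  have hbt : b ≤ t := le_of_not_gt fun h2 => htn ⟨hta, h2⟩
  set v := (t - s)⁻¹ • (γ t - γ s) with hv
  have hd : ∀ᵐ τ ∂(volume.restrict (Ioo a b)), deriv (_root_.shortcut γ s t) τ = v := by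
    filter_upwards [ae_restrict_mem measurableSet_Ioo] with τ hτ
    exact deriv_shortcut_of_mem (Ioo_subset_Ioo hsa hbt hτ)
  rcases eq_or_ne v 0 with hv0 | hv0
  · refine ⟨u₀, hu₀, ?_⟩
    filter_upwards [hd] with τ hτ
    rw [hτ, hv0, norm_zero, zero_smul]
  · refine ⟨‖v‖⁻¹ • v, norm_smul_inv_norm (𝕜 := ℝ) hv0, ?_⟩
    filter_upwards [hd] with τ hτ
    rw [hτ, smul_smul, mul_inv_cancel₀ (norm_ne_zero_iff.2 hv0), one_smul]

variable {m p β : ℝ} {μ : Measure (Euc d)}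

lemma IsGeodesic.fdtmLength_le (hm : m ∈ Set.Ioo (0 : ℝ) 1) {F : Set (Euc d)} {x y : Euc d}
    (h : IsGeodesic m p β μ F x y γ) {η : ℝ → Euc d} (hη : AdmissiblePath F x y η) :
    fdtmLength m p β μ γ ≤ fdtmLength m p β μ η := by
  rw [h.2]
  refine csInf_le ⟨0, ?_⟩ ⟨η, hη, rfl⟩
  rintro _ ⟨ζ, -, rfl⟩
  exact integral_nonneg fun τ => mul_nonneg (Real.rpow_nonneg (dtm_nonneg μ hm _) β) (norm_nonneg _)

variable [IsProbabilityMeasure μ]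

lemma integrableOn_fdtm (hm : m ∈ Set.Ioo (0 : ℝ) 1) (hp : 1 ≤ p) (hβ : 0 ≤ β) {K : ℝ≥0}
    (hγ : LipschitzWith K γ) (a b : ℝ) :
    IntegrableOn (fun τ => dtm m p μ (γ τ) ^ β * ‖deriv γ τ‖) (Icc a b) := by
  refine (integrableOn_norm_deriv hγ a b).continuousOn_mul ?_ isCompact_Icc
  exact (((lipschitzWith_dtm μ hm hp).continuous.comp hγ.continuous).rpow_const
    fun _ => Or.inr hβ).continuousOn

/-- Between two times at which a geodesic is in the domain, it costs at most as much as a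
straight segment. -/
lemma IsGeodesic.pathCost_Icc_le (hm : m ∈ Set.Ioo (0 : ℝ) 1) (hp : 1 ≤ p) (hβ : 0 ≤ β)
    {F : Set (Euc d)} {x y : Euc d} (h : IsGeodesic m p β μ F x y γ)
    (hs0 : 0 ≤ s) (hst : s ≤ t) (ht1 : t ≤ 1) (hs : γ s ∈ F) (ht : γ t ∈ F) {B : ℝ}
    (hB : ∀ θ ∈ Icc (0 : ℝ) 1, dtm m p μ (γ s + θ • (γ t - γ s)) ≤ B) :
    pathCost (dtm m p μ) β γ (Icc s t) ≤ ENNReal.ofReal (B ^ β * dist (γ s) (γ t)) := by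
  rcases hst.eq_or_lt with rfl | hst
  · refine le_trans (le_of_eq ?_) zero_le
    rw [Icc_self]
    exact ((withDensity_absolutelyContinuous _ _).trans
      Measure.absolutelyContinuous_restrict) (by simp)
  obtain ⟨K, hK⟩ := h.1.1
  obtain ⟨K', hK'⟩ := lipschitzWith_shortcut (s := s) (t := t) hK
  have hsub : Icc s t ⊆ Icc 0 1 := Icc_subset_Icc hs0 ht1
  set f : (ℝ → Euc d) → ℝ → ℝ := fun η τ => dtm m p μ (η τ) ^ β * ‖deriv η τ‖ with hf
  have hle : ∫ τ in Icc 0 1, f γ τ ≤ ∫ τ in Icc 0 1, f (shortcut γ s t) τ :=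
    h.fdtmLength_le hm (h.1.shortcut hs0 hst ht1 hs ht)
  have hdiff : ∫ τ in Icc 0 1 \ Icc s t, f γ τ =
      ∫ τ in Icc 0 1 \ Icc s t, f (shortcut γ s t) τ := by
    refine setIntegral_congr_fun (measurableSet_Icc.diff measurableSet_Icc) fun τ hτ => ?_
    simp only [hf]
    rw [deriv_shortcut_of_notMem hst hτ.2]
    rcases lt_or_ge τ s with h2 | h2
    · rw [shortcut_of_le hst h2.le]
    · rw [shortcut_of_ge hst (le_of_not_ge fun h3 => hτ.2 ⟨h2, h3⟩)]
  rw [← integral_inter_add_sdiff measurableSet_Icc (integrableOn_fdtm hm hp hβ hK 0 1),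
    ← integral_inter_add_sdiff measurableSet_Icc (integrableOn_fdtm hm hp hβ hK' 0 1), hdiff,
    inter_eq_self_of_subset_right hsub] at hle
  have hle' := le_of_add_le_add_right hle
  have hseg : ∫ τ in Icc s t, f (shortcut γ s t) τ ≤ B ^ β * dist (γ s) (γ t) := by
    have hbd : ∀ τ ∈ Ioo s t,
        f (shortcut γ s t) τ ≤ B ^ β * ((t - s)⁻¹ * dist (γ s) (γ t)) := by
      intro τ hτ
      have hts : 0 < t - s := sub_pos.2 hst
      simp only [hf]
      rw [deriv_shortcut_of_mem hτ, shortcut_of_mem (Ioo_subset_Icc_self hτ), norm_smul,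
        norm_inv, Real.norm_of_nonneg hts.le, dist_comm, dist_eq_norm, smul_smul]
      refine mul_le_mul_of_nonneg_right (Real.rpow_le_rpow (dtm_nonneg μ hm _) (hB _ ?_) hβ)
        (by positivity)
      rw [← div_eq_mul_inv]
      exact ⟨div_nonneg (sub_nonneg.2 hτ.1.le) hts.le, (div_le_one hts).2 (by linarith [hτ.2])⟩
    rw [integral_Icc_eq_integral_Ioo]
    calc ∫ τ in Ioo s t, f (shortcut γ s t) τ
        ≤ ∫ _ in Ioo s t, B ^ β * ((t - s)⁻¹ * dist (γ s) (γ t)) :=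
          setIntegral_mono_on ((integrableOn_fdtm hm hp hβ hK' s t).mono_set Ioo_subset_Icc_self)
            (integrableOn_const measure_Ioo_lt_top.ne) measurableSet_Ioo hbd
      _ = B ^ β * dist (γ s) (γ t) := by
          rw [setIntegral_const, Real.volume_real_Ioo_of_le hst.le, smul_eq_mul]
          have : t - s ≠ 0 := (sub_pos.2 hst).ne'
          field_simp
  rw [pathCost, withDensity_apply _ measurableSet_Icc, Measure.restrict_restrict measurableSet_Icc,
    inter_eq_self_of_subset_left hsub,
    ← ofReal_integral_eq_lintegral_ofReal (integrableOn_fdtm hm hp hβ hK s t)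
      (Filter.Eventually.of_forall fun τ =>
        mul_nonneg (Real.rpow_nonneg (dtm_nonneg μ hm _) β) (norm_nonneg _))]
  exact ENNReal.ofReal_le_ofReal (hle'.trans hseg)

end Shortcut

section Levels

variable {d : ℕ}

/-- Data on a weight `w` and a path `γ` with domain `F` that control the Euclidean length of `γ`:
sublevel sets of `w` are covered by at most `N` balls of comparable radius, `γ` is straight outside
of `F`, and it is cheaper than straight segments between points of `F`. -/
structure IsFermatPath (w : Euc d → ℝ) (N β : ℝ) (F : Set (Euc d)) (γ : ℝ → Euc d) : Prop where
  exponent_nonneg : 0 ≤ β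
  one_le_card : 1 ≤ N
  nonneg : ∀ x, 0 ≤ w x
  lipschitz_weight : LipschitzWith 1 w
  cover : ∀ ρ : ℝ, 0 < ρ → ∃ C : Finset (Euc d), (C.card : ℝ) ≤ N ∧
    ∀ x, w x ≤ ρ → ∃ c ∈ C, dist x c ≤ 6 * ρ
  isClosed : IsClosed F
  lipschitz : ∃ K, LipschitzWith K γ
  straight : ∀ a b : ℝ, 0 ≤ a → b ≤ 1 → (∀ t ∈ Ioo a b, γ t ∉ F) → IsStraightOn γ a b
  cost_le : ∀ s t B : ℝ, 0 ≤ s → s ≤ t → t ≤ 1 → γ s ∈ F → γ t ∈ F →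
    (∀ θ ∈ Icc (0 : ℝ) 1, w (γ s + θ • (γ t - γ s)) ≤ B) →
    pathCost w β γ (Icc s t) ≤ ENNReal.ofReal (B ^ β * dist (γ s) (γ t))

/-- The interval `(c.1, c.2)` is a maximal time interval on which `γ` is outside of `F`. -/
structure IsChord (F : Set (Euc d)) (γ : ℝ → Euc d) (c : ℝ × ℝ) : Prop where
  nonneg : 0 ≤ c.1
  lt : c.1 < c.2
  le_one : c.2 ≤ 1
  left_mem : γ c.1 ∈ F
  right_mem : γ c.2 ∈ F
  notMem : ∀ t ∈ Ioo c.1 c.2, γ t ∉ F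

/-- Chords along which the maximum of `w` lies in `(q/2, q]`. -/
def levelChords (w : Euc d → ℝ) (F : Set (Euc d)) (γ : ℝ → Euc d) (q : ℝ) : Set (ℝ × ℝ) :=
  {c | IsChord F γ c ∧ (∀ t ∈ Icc c.1 c.2, w (γ t) ≤ q) ∧ ∃ t ∈ Icc c.1 c.2, q / 2 < w (γ t)}

/-- Times in the domain at which `w` lies in `(q/2, q]`. -/
def levelTimes (w : Euc d → ℝ) (F : Set (Euc d)) (γ : ℝ → Euc d) (q : ℝ) : Set ℝ :=
  {t ∈ Icc 0 1 | γ t ∈ F ∧ q / 2 < w (γ t) ∧ w (γ t) ≤ q}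

variable {w : Euc d → ℝ} {N β : ℝ} {F : Set (Euc d)} {γ : ℝ → Euc d}

lemma IsChord.le_left {c : ℝ × ℝ} (hc : IsChord F γ c) {t τ : ℝ} (ht : γ t ∈ F)
    (hτ : τ ∈ Ioo c.1 c.2) (h : t ≤ τ) : t ≤ c.1 :=
  le_of_not_gt fun h1 => hc.notMem t ⟨h1, h.trans_lt hτ.2⟩ ht

lemma IsChord.right_le {c : ℝ × ℝ} (hc : IsChord F γ c) {t τ : ℝ} (ht : γ t ∈ F)
    (hτ : τ ∈ Ioo c.1 c.2) (h : τ ≤ t) : c.2 ≤ t :=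
  le_of_not_gt fun h1 => hc.notMem t ⟨hτ.1.trans_le h, h1⟩ ht

lemma IsChord.eq_of_mem {c e : ℝ × ℝ} (hc : IsChord F γ c) (he : IsChord F γ e) {τ : ℝ}
    (hcτ : τ ∈ Ioo c.1 c.2) (heτ : τ ∈ Ioo e.1 e.2) : c = e :=
  Prod.ext
    (le_antisymm (he.le_left hc.left_mem heτ hcτ.1.le) (hc.le_left he.left_mem hcτ heτ.1.le))
    (le_antisymm (hc.right_le he.right_mem hcτ heτ.2.le) (he.right_le hc.right_mem heτ hcτ.2.le))

lemma pairwiseDisjoint_chords :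
    {c | IsChord F γ c}.PairwiseDisjoint fun c : ℝ × ℝ => Ioo c.1 c.2 := fun _ hc _ he hne =>
  Set.disjoint_left.2 fun _ h1 h2 => hne (IsChord.eq_of_mem hc he h1 h2)

lemma countable_chords : {c | IsChord F γ c}.Countable :=
  pairwiseDisjoint_chords.countable_of_isOpen (fun _ _ => isOpen_Ioo)
    fun _ hc => nonempty_Ioo.2 (IsChord.lt hc)

lemma levelChords_subset (q : ℝ) : levelChords w F γ q ⊆ {c | IsChord F γ c} := fun _ hc => hc.1

lemma IsFermatPath.pathLen_chord_le (h : IsFermatPath w N β F γ) {q : ℝ} (hq : 0 < q) {c : ℝ × ℝ}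
    (hc : c ∈ levelChords w F γ q) :
    ENNReal.ofReal ((q / (96 * N)) ^ β) * pathLen γ (Ioo c.1 c.2) ≤
      2 * pathCost w β γ (Ioo c.1 c.2) := by
  obtain ⟨K, hK⟩ := h.lipschitz
  obtain ⟨hch, -, s, hs, hsq⟩ := hc
  have hN := h.one_le_card
  have hN0 : 0 < N := one_pos.trans_le hN
  have hst := h.straight _ _ hch.nonneg hch.le_one hch.notMem
  set ρ := q / (96 * N) with hρ
  have hρ0 : 0 < ρ := by positivity
  have hρq : ρ ≤ q / 4 := div_le_div_of_nonneg_left hq.le (by norm_num) (by linarith)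
  have hcont : Continuous fun t => w (γ t) := h.lipschitz_weight.continuous.comp hK.continuous
  set J := Ioo c.1 c.2
  set S₁ := J ∩ {t | w (γ t) ≤ ρ} with hS₁
  set S₂ := J ∩ {t | ρ < w (γ t)} with hS₂
  have hS₂m : MeasurableSet S₂ :=
    measurableSet_Ioo.inter (isOpen_lt continuous_const hcont).measurableSet
  have hJ : pathLen γ J ≤ pathLen γ S₁ + pathLen γ S₂ := by
    refine (measure_mono fun t ht => ?_).trans (measure_union_le _ _)
    rcases le_or_gt (w (γ t)) ρ with h1 | h1
    exacts [Or.inl ⟨ht, h1⟩, Or.inr ⟨ht, h1⟩]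
  have h12 : pathLen γ S₁ ≤ pathLen γ S₂ := by
    rcases S₁.eq_empty_or_nonempty with he | ⟨t, ht⟩
    · simp [he]
    obtain ⟨C, hC, hcov⟩ := h.cover ρ hρ0
    have h1 : pathLen γ S₁ ≤ ENNReal.ofReal (q / 8) := by
      refine (hst.pathLen_le_of_cover hK hch.nonneg hch.le_one (by positivity) hC
        (fun τ hτ => Ioo_subset_Icc_self hτ.1) fun τ hτ => hcov _ hτ.2).trans
          (ENNReal.ofReal_le_ofReal (le_of_eq ?_))
      rw [hρ]
      field_simp
      norm_num
    have h2 : ENNReal.ofReal (q / 4) ≤ pathLen γ J := by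
      refine le_trans (ENNReal.ofReal_le_ofReal ?_)
        (dist_le_pathLen hK hch.nonneg hch.le_one hs (Ioo_subset_Icc_self ht.1))
      have h3 := h.lipschitz_weight.le_add_mul (γ s) (γ t)
      have h4 : w (γ t) ≤ ρ := ht.2
      rw [NNReal.coe_one, one_mul] at h3
      linarith
    have h3 : pathLen γ S₁ + pathLen γ S₁ ≤ pathLen γ S₁ + pathLen γ S₂ := by
      refine le_trans ((add_le_add h1 h1).trans ?_) (h2.trans hJ)
      rw [← ENNReal.ofReal_add (by positivity) (by positivity)]
      exact ENNReal.ofReal_le_ofReal (by linarith)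
    exact (ENNReal.add_le_add_iff_left (h1.trans_lt ENNReal.ofReal_lt_top).ne).1 h3
  calc ENNReal.ofReal (ρ ^ β) * pathLen γ J
      ≤ ENNReal.ofReal (ρ ^ β) * (2 * pathLen γ S₂) := by
        gcongr
        rw [two_mul]
        exact hJ.trans (add_le_add_left h12 _)
    _ = 2 * (ENNReal.ofReal (ρ ^ β) * pathLen γ S₂) := by ring
    _ ≤ 2 * pathCost w β γ S₂ := by
        gcongr
        exact mul_pathLen_le_pathCost h.exponent_nonneg hρ0.le hS₂m fun t ht => ht.2.le
    _ ≤ 2 * pathCost w β γ J := by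
        gcongr
        exact inter_subset_left

lemma IsFermatPath.pathLen_level_le (h : IsFermatPath w N β F γ) {q : ℝ} (hq : 0 < q) :
    ENNReal.ofReal ((q / (96 * N)) ^ β) *
        pathLen γ (levelTimes w F γ q ∪ ⋃ c ∈ levelChords w F γ q, Ioo c.1 c.2) ≤
      2 * pathCost w β γ (levelTimes w F γ q ∪ ⋃ c ∈ levelChords w F γ q, Ioo c.1 c.2) := by
  obtain ⟨K, hK⟩ := h.lipschitz
  have hN := h.one_le_card
  have hN0 : 0 < N := one_pos.trans_le hN
  have hcount := countable_chords.mono (levelChords_subset (w := w) (F := F) (γ := γ) q)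
  have hdisj := (pairwiseDisjoint_chords (F := F) (γ := γ)).subset
    (levelChords_subset (w := w) q)
  have hcont : Continuous fun t => w (γ t) := h.lipschitz_weight.continuous.comp hK.continuous
  have hTm : MeasurableSet (levelTimes w F γ q) :=
    measurableSet_Icc.inter ((h.isClosed.preimage hK.continuous).measurableSet.inter
      ((isOpen_lt continuous_const hcont).measurableSet.inter
        (isClosed_le hcont continuous_const).measurableSet))
  have hUm : MeasurableSet (⋃ c ∈ levelChords w F γ q, Ioo c.1 c.2) :=
    .biUnion hcount fun _ _ => measurableSet_Ioo
  have hTU : Disjoint (levelTimes w F γ q) (⋃ c ∈ levelChords w F γ q, Ioo c.1 c.2) := by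
    refine Set.disjoint_left.2 fun t ht htU => ?_
    obtain ⟨c, hc, htc⟩ := mem_iUnion₂.1 htU
    exact hc.1.notMem t htc ht.2.1
  have hρq : q / (96 * N) ≤ q / 2 := div_le_div_of_nonneg_left hq.le (by norm_num) (by linarith)
  have h1 : ENNReal.ofReal ((q / (96 * N)) ^ β) * pathLen γ (levelTimes w F γ q) ≤
      2 * pathCost w β γ (levelTimes w F γ q) :=
    (mul_pathLen_le_pathCost h.exponent_nonneg (by positivity) hTm
      fun t ht => hρq.trans ht.2.2.1.le).trans (le_mul_of_one_le_left' one_le_two)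
  rw [measure_union hTU hUm, measure_union hTU hUm, measure_biUnion hcount hdisj
    fun _ _ => measurableSet_Ioo, measure_biUnion hcount hdisj fun _ _ => measurableSet_Ioo,
    mul_add, mul_add, ← ENNReal.tsum_mul_left, ← ENNReal.tsum_mul_left]
  exact add_le_add h1 (ENNReal.tsum_le_tsum fun c => h.pathLen_chord_le hq c.2)

/-- The times at which the path visits the domain in a small ball, together with the chords of the
level that start there, are contained in a set of small cost. -/
lemma IsFermatPath.exists_hull (h : IsFermatPath w N β F γ) {q : ℝ} (hq : 0 < q) (c : Euc d) :
    ∃ H : Set ℝ, pathCost w β γ H ≤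
        ENNReal.ofReal ((13 * q) ^ β * (12 * q) + q ^ β * (N * (12 * q))) ∧
      ∀ t ∈ Icc (0 : ℝ) 1, γ t ∈ F → w (γ t) ≤ q → dist (γ t) c ≤ 6 * q →
        t ∈ H ∧ ∀ e ∈ levelChords w F γ q, e.1 = t → Ioo e.1 e.2 ⊆ H := by
  obtain ⟨K, hK⟩ := h.lipschitz
  have hN := h.one_le_card
  have hN0 : 0 < N := one_pos.trans_le hN
  have hcont : Continuous fun t => w (γ t) := h.lipschitz_weight.continuous.comp hK.continuous
  set P : Set ℝ := Icc 0 1 ∩ {t | γ t ∈ F ∧ w (γ t) ≤ q ∧ dist (γ t) c ≤ 6 * q} with hP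
  have hPc : IsCompact P := isCompact_Icc.inter_right
    ((h.isClosed.preimage hK.continuous).inter ((isClosed_le hcont continuous_const).inter
      (isClosed_le (hK.continuous.dist continuous_const) continuous_const)))
  rcases P.eq_empty_or_nonempty with he | hne
  · refine ⟨∅, by simp, fun t ht h1 h2 h3 => absurd (show t ∈ P from ⟨ht, h1, h2, h3⟩) ?_⟩
    simp [he]
  have hsP := hPc.sInf_mem hne
  have htP := hPc.sSup_mem hne
  set s := sInf P
  set t := sSup P
  have hle : ∀ τ ∈ P, s ≤ τ ∧ τ ≤ t := fun τ hτ =>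
    ⟨csInf_le hPc.bddBelow hτ, le_csSup hPc.bddAbove hτ⟩
  have hdist : dist (γ s) (γ t) ≤ 12 * q := by
    linarith [dist_triangle_right (γ s) (γ t) c, hsP.2.2.2, htP.2.2.2]
  have hmain : pathCost w β γ (Icc s t) ≤ ENNReal.ofReal ((13 * q) ^ β * (12 * q)) := by
    refine (h.cost_le s t (13 * q) hsP.1.1 (hle t htP).1 htP.1.2 hsP.2.1 htP.2.1 fun θ hθ => ?_).trans
      (ENNReal.ofReal_le_ofReal (by gcongr))
    have h1 := h.lipschitz_weight.le_add_mul (γ s + θ • (γ t - γ s)) (γ s)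
    rw [NNReal.coe_one, one_mul, dist_self_add_left, norm_smul, Real.norm_of_nonneg hθ.1,
      ← dist_eq_norm, dist_comm] at h1
    have h2 : θ * dist (γ s) (γ t) ≤ 1 * dist (γ s) (γ t) :=
      mul_le_mul_of_nonneg_right hθ.2 dist_nonneg
    linarith [hsP.2.2.1]
  have hin : ∀ τ ∈ P, ∀ e ∈ levelChords w F γ q, e.1 = τ → τ ≠ t → Ioo e.1 e.2 ⊆ Icc s t := by
    rintro τ hτ e he rfl hτt
    have h1 : e.2 ≤ t := le_of_not_gt fun h2 =>
      he.1.notMem t ⟨lt_of_le_of_ne (hle _ hτ).2 hτt, h2⟩ htP.2.1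
    exact (Ioo_subset_Ioo (hle _ hτ).1 h1).trans Ioo_subset_Icc_self
  have hX : ENNReal.ofReal ((13 * q) ^ β * (12 * q) + q ^ β * (N * (12 * q))) =
      ENNReal.ofReal ((13 * q) ^ β * (12 * q)) + ENNReal.ofReal (q ^ β * (N * (12 * q))) :=
    ENNReal.ofReal_add (by positivity) (by positivity)
  by_cases hgap : ∃ e ∈ levelChords w F γ q, e.1 = t
  · obtain ⟨e, he, het⟩ := hgap
    have hgapcost : pathCost w β γ (Ioo e.1 e.2) ≤ ENNReal.ofReal (q ^ β * (N * (12 * q))) := by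
      obtain ⟨C, hC, hcov⟩ := h.cover q hq
      have hst := h.straight _ _ he.1.nonneg he.1.le_one he.1.notMem
      have hlen := hst.pathLen_le_of_cover hK he.1.nonneg he.1.le_one
        (R := 6 * q) (by positivity) hC (S := Ioo e.1 e.2) Ioo_subset_Icc_self
        fun τ hτ => hcov _ (he.2.1 τ (Ioo_subset_Icc_self hτ))
      refine (pathCost_le_mul_pathLen h.exponent_nonneg h.nonneg measurableSet_Ioo
        fun τ hτ => he.2.1 τ (Ioo_subset_Icc_self hτ)).trans ?_
      rw [ENNReal.ofReal_mul (by positivity)]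
      refine mul_le_mul_right (hlen.trans (ENNReal.ofReal_le_ofReal (le_of_eq ?_))) _
      ring
    refine ⟨Icc s t ∪ Ioo e.1 e.2, ?_, fun τ hτ h1 h2 h3 => ?_⟩
    · rw [hX]
      exact (measure_union_le _ _).trans (add_le_add hmain hgapcost)
    · have hτP : τ ∈ P := ⟨hτ, h1, h2, h3⟩
      refine ⟨Or.inl (hle τ hτP), fun e' he' h4 => ?_⟩
      by_cases hτt : τ = t
      · have hlt1 := he.1.lt
        have hlt2 := he'.1.lt
        obtain ⟨x, hx1, hx2⟩ := exists_between (lt_min (het ▸ hlt1) ((h4.trans hτt) ▸ hlt2))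
        rw [IsChord.eq_of_mem he'.1 he.1 (τ := x)
          ⟨by rw [h4, hτt]; exact hx1, hx2.trans_le (min_le_right _ _)⟩
          ⟨by rw [het]; exact hx1, hx2.trans_le (min_le_left _ _)⟩]
        exact subset_union_right
      · exact (hin τ hτP e' he' h4 hτt).trans subset_union_left
  · refine ⟨Icc s t, hmain.trans (by rw [hX]; exact le_self_add), fun τ hτ h1 h2 h3 => ?_⟩
    have hτP : τ ∈ P := ⟨hτ, h1, h2, h3⟩
    refine ⟨hle τ hτP, fun e he h4 => hin τ hτP e he h4 ?_⟩
    rintro rfl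
    exact hgap ⟨e, he, h4⟩

lemma IsFermatPath.pathCost_level_le (h : IsFermatPath w N β F γ) {q : ℝ} (hq : 0 < q) :
    pathCost w β γ (levelTimes w F γ q ∪ ⋃ c ∈ levelChords w F γ q, Ioo c.1 c.2) ≤
      ENNReal.ofReal (N * ((13 * q) ^ β * (12 * q) + q ^ β * (N * (12 * q)))) := by
  have hN0 : 0 < N := one_pos.trans_le h.one_le_card
  obtain ⟨C, hC, hcov⟩ := h.cover q hq
  choose H hH hsub using fun c => h.exists_hull hq c
  have hcover : levelTimes w F γ q ∪ ⋃ c ∈ levelChords w F γ q, Ioo c.1 c.2 ⊆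
      ⋃ c ∈ C, H c := by
    refine union_subset (fun t ht => ?_) (iUnion₂_subset fun e he => ?_)
    · obtain ⟨c, hc, hd⟩ := hcov _ ht.2.2.2
      exact mem_iUnion₂.2 ⟨c, hc, (hsub c t ht.1 ht.2.1 ht.2.2.2 hd).1⟩
    · have hw := he.2.1 e.1 (left_mem_Icc.2 he.1.lt.le)
      obtain ⟨c, hc, hd⟩ := hcov _ hw
      exact ((hsub c e.1 ⟨he.1.nonneg, he.1.lt.le.trans he.1.le_one⟩ he.1.left_mem hw hd).2 e he
        rfl).trans (subset_biUnion_of_mem (u := H) (Finset.mem_coe.2 hc))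
  set X := (13 * q) ^ β * (12 * q) + q ^ β * (N * (12 * q)) with hX
  have hX0 : 0 ≤ X := by positivity
  calc _ ≤ ∑ c ∈ C, pathCost w β γ (H c) :=
        (measure_mono hcover).trans (measure_biUnion_finset_le _ _)
    _ ≤ ∑ c ∈ C, ENNReal.ofReal X := Finset.sum_le_sum fun c _ => hH c
    _ = ENNReal.ofReal (C.card * X) := by
        rw [Finset.sum_const, nsmul_eq_mul, ENNReal.ofReal_mul (Nat.cast_nonneg _),
          ENNReal.ofReal_natCast]
    _ ≤ ENNReal.ofReal (N * X) := by gcongr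

lemma IsFermatPath.pathLen_level_le_mul (h : IsFermatPath w N β F γ) {q : ℝ} (hq : 0 < q) :
    pathLen γ (levelTimes w F γ q ∪ ⋃ c ∈ levelChords w F γ q, Ioo c.1 c.2) ≤
      ENNReal.ofReal (48 * N ^ 2 * (1248 * N) ^ β * q) := by
  have hN := h.one_le_card
  have hN0 : 0 < N := one_pos.trans_le hN
  have hβ := h.exponent_nonneg
  have hρ0 : 0 < (q / (96 * N)) ^ β := by positivity
  have h1 := (h.pathLen_level_le hq).trans (mul_le_mul_right (h.pathCost_level_le hq) 2)
  rw [mul_comm, ← ENNReal.le_div_iff_mul_le (Or.inl (by simpa using hρ0)) (Or.inl (by simp)),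
    ← ENNReal.ofReal_ofNat, ← ENNReal.ofReal_mul (by norm_num), ← ENNReal.ofReal_div_of_pos hρ0]
    at h1
  refine h1.trans (ENNReal.ofReal_le_ofReal ?_)
  rw [div_le_iff₀ hρ0]
  have e1 : (1248 * N) ^ β * (q / (96 * N)) ^ β = (13 * q) ^ β := by
    rw [← Real.mul_rpow (by positivity) (by positivity)]
    congr 1
    field_simp
    norm_num
  have e2 : q ^ β ≤ (13 * q) ^ β := Real.rpow_le_rpow hq.le (by linarith) hβ
  have e3 : (13 * q) ^ β * (12 * q) ≤ (13 * q) ^ β * (N * (12 * q)) :=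
    mul_le_mul_of_nonneg_left (le_mul_of_one_le_left (by positivity) hN) (by positivity)
  calc 2 * (N * ((13 * q) ^ β * (12 * q) + q ^ β * (N * (12 * q))))
      ≤ 2 * (N * ((13 * q) ^ β * (N * (12 * q)) + (13 * q) ^ β * (N * (12 * q)))) := by gcongr
    _ = 48 * N ^ 2 * ((1248 * N) ^ β * (q / (96 * N)) ^ β) * q := by rw [e1]; ring
    _ = _ := by ring

end Levels

section Length

variable {d : ℕ} {w : Euc d → ℝ} {N β M : ℝ} {F : Set (Euc d)} {γ : ℝ → Euc d}

lemma exists_isChord (hF : IsClosed F) (hγ : Continuous γ) {a b τ : ℝ} (ha : 0 ≤ a) (hb : b ≤ 1)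
    (haτ : a ≤ τ) (hτb : τ ≤ b) (haF : γ a ∈ F) (hbF : γ b ∈ F) (hτ : γ τ ∉ F) :
    ∃ c, IsChord F γ c ∧ τ ∈ Ioo c.1 c.2 := by
  have h1 : IsCompact (Icc a τ ∩ γ ⁻¹' F) := isCompact_Icc.inter_right (hF.preimage hγ)
  have h2 : IsCompact (Icc τ b ∩ γ ⁻¹' F) := isCompact_Icc.inter_right (hF.preimage hγ)
  have hs := h1.sSup_mem ⟨a, left_mem_Icc.2 haτ, haF⟩
  have ht := h2.sInf_mem ⟨b, right_mem_Icc.2 hτb, hbF⟩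
  have hle := fun x hx => le_csSup h1.bddAbove (a := x) hx
  have hge := fun x hx => csInf_le h2.bddBelow (a := x) hx
  set s := sSup (Icc a τ ∩ γ ⁻¹' F)
  set t := sInf (Icc τ b ∩ γ ⁻¹' F)
  have hsτ : s < τ := lt_of_le_of_ne hs.1.2 fun h => hτ (h ▸ hs.2)
  have hτt : τ < t := lt_of_le_of_ne ht.1.1 fun h => hτ (h ▸ ht.2)
  refine ⟨(s, t), ⟨ha.trans hs.1.1, hsτ.trans hτt, ht.1.2.trans hb, hs.2, ht.2, fun x hx hxF => ?_⟩,
    hsτ, hτt⟩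
  rcases le_total x τ with h | h
  · exact hx.1.not_ge (hle x ⟨⟨hs.1.1.trans hx.1.le, h⟩, hxF⟩)
  · exact hx.2.not_ge (hge x ⟨⟨h, hx.2.le.trans ht.1.2⟩, hxF⟩)

lemma exists_dyadic_level (hM : 0 < M) {v : ℝ} (hv : 0 < v) (hvM : v ≤ M) :
    ∃ k : ℕ, M * (1 / 2) ^ k / 2 < v ∧ v ≤ M * (1 / 2) ^ k := by
  obtain ⟨k, h1, h2⟩ := exists_nat_pow_near_of_lt_one (div_pos hv hM) ((div_le_one hM).2 hvM)
    (y := (1 / 2 : ℝ)) (by norm_num) (by norm_num)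
  rw [lt_div_iff₀ hM, pow_succ] at h1
  rw [div_le_iff₀ hM] at h2
  exact ⟨k, by linarith, by linarith⟩

lemma IsFermatPath.pathLen_Icc_le_of_notMem (h : IsFermatPath w N β F γ) (hM : 0 < M)
    (hle : ∀ t ∈ Icc (0 : ℝ) 1, w (γ t) ≤ M) {a b : ℝ} (ha : 0 ≤ a) (hb : b ≤ 1)
    (hab : ∀ t ∈ Ioo a b, γ t ∉ F) : pathLen γ (Icc a b) ≤ ENNReal.ofReal (12 * N * M) := by
  obtain ⟨K, hK⟩ := h.lipschitz
  obtain ⟨C, hC, hcov⟩ := h.cover M hM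
  refine ((h.straight a b ha hb hab).pathLen_le_of_cover hK ha hb (R := 6 * M) (by positivity) hC
    Subset.rfl fun t ht => hcov _ (hle t (Icc_subset_Icc ha hb ht))).trans (le_of_eq ?_)
  congr 1
  ring

/-- Between two visits to the domain, the path is made of dyadic levels, up to times at which the
weight vanishes. -/
lemma IsFermatPath.Icc_subset_iUnion_level (h : IsFermatPath w N β F γ) (hM : 0 < M)
    (hle : ∀ t ∈ Icc (0 : ℝ) 1, w (γ t) ≤ M) {a b : ℝ} (ha : 0 ≤ a) (hb : b ≤ 1)
    (haF : γ a ∈ F) (hbF : γ b ∈ F) :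
    Icc a b ⊆ γ ⁻¹' {x | w x = 0} ∪ ⋃ k : ℕ, (levelTimes w F γ (M * (1 / 2) ^ k) ∪
      ⋃ c ∈ levelChords w F γ (M * (1 / 2) ^ k), Ioo c.1 c.2) := by
  obtain ⟨K, hK⟩ := h.lipschitz
  intro τ hτ
  have hτ1 := Icc_subset_Icc ha hb hτ
  rcases (h.nonneg (γ τ)).eq_or_lt with h0 | h0
  · exact Or.inl h0.symm
  refine Or.inr (mem_iUnion.2 ?_)
  by_cases hF : γ τ ∈ F
  · obtain ⟨k, h1, h2⟩ := exists_dyadic_level hM h0 (hle τ hτ1)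
    exact ⟨k, Or.inl ⟨hτ1, hF, h1, h2⟩⟩
  obtain ⟨c, hc, hτc⟩ := exists_isChord h.isClosed hK.continuous ha hb hτ.1 hτ.2 haF hbF hF
  obtain ⟨s, hs, hmax⟩ := isCompact_Icc.exists_isMaxOn (nonempty_Icc.2 hc.lt.le)
    (h.lipschitz_weight.continuous.comp hK.continuous).continuousOn
  have hmax' : ∀ t ∈ Icc c.1 c.2, w (γ t) ≤ w (γ s) := fun t ht => hmax ht
  obtain ⟨k, h1, h2⟩ := exists_dyadic_level hM
    (h0.trans_le (hmax' τ (Ioo_subset_Icc_self hτc)))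
    (hle s (Icc_subset_Icc hc.nonneg hc.le_one hs))
  exact ⟨k, Or.inr (mem_iUnion₂.2
    ⟨c, ⟨hc, fun t ht => (hmax' t ht).trans h2, s, hs, h1⟩, hτc⟩)⟩

lemma IsFermatPath.pathLen_Icc_le_of_mem (h : IsFermatPath w N β F γ) (hM : 0 < M)
    (hle : ∀ t ∈ Icc (0 : ℝ) 1, w (γ t) ≤ M) (hfin : {x | w x = 0}.Finite) {a b : ℝ} (ha : 0 ≤ a)
    (hb : b ≤ 1) (haF : γ a ∈ F) (hbF : γ b ∈ F) :
    pathLen γ (Icc a b) ≤ ENNReal.ofReal (96 * N ^ 2 * (1248 * N) ^ β * M) := by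
  obtain ⟨K, hK⟩ := h.lipschitz
  have hN0 : 0 < N := one_pos.trans_le h.one_le_card
  refine (measure_mono (h.Icc_subset_iUnion_level hM hle ha hb haF hbF)).trans
    ((measure_union_le _ _).trans ?_)
  rw [pathLen_preimage_finite hK hfin, zero_add]
  set A := 48 * N ^ 2 * (1248 * N) ^ β with hA
  have hA0 : 0 ≤ A := by positivity
  have hsum : Summable fun k : ℕ => A * (M * (1 / 2 : ℝ) ^ k) :=
    (summable_geometric_two.mul_left M).mul_left A
  refine (measure_iUnion_le _).trans
    ((ENNReal.tsum_le_tsum fun k => h.pathLen_level_le_mul (by positivity)).trans (le_of_eq ?_))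
  rw [← ENNReal.ofReal_tsum_of_nonneg (fun k => by positivity) hsum, tsum_mul_left, tsum_mul_left,
    tsum_geometric_two]
  congr 1
  rw [hA]
  ring

theorem IsFermatPath.pathLen_le (h : IsFermatPath w N β F γ) (hM : 0 ≤ M)
    (hle : ∀ t ∈ Icc (0 : ℝ) 1, w (γ t) ≤ M) (hfin : {x | w x = 0}.Finite) :
    pathLen γ (Icc 0 1) ≤ ENNReal.ofReal ((24 * N + 96 * N ^ 2 * (1248 * N) ^ β) * M) := by
  obtain ⟨K, hK⟩ := h.lipschitz
  have hN0 : 0 < N := one_pos.trans_le h.one_le_card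
  rcases hM.eq_or_lt with rfl | hM
  · have hsub : Icc (0 : ℝ) 1 ⊆ γ ⁻¹' {x | w x = 0} := fun t ht =>
      le_antisymm (hle t ht) (h.nonneg _)
    simp [measure_mono_null hsub (pathLen_preimage_finite hK hfin)]
  rcases (Icc (0 : ℝ) 1 ∩ γ ⁻¹' F).eq_empty_or_nonempty with he | hne
  · refine (h.pathLen_Icc_le_of_notMem hM hle le_rfl le_rfl fun t ht htF =>
      he.subset ⟨Ioo_subset_Icc_self ht, htF⟩).trans (ENNReal.ofReal_le_ofReal ?_)
    have : 0 ≤ 96 * N ^ 2 * (1248 * N) ^ β := by positivity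
    gcongr
    linarith
  have hc : IsCompact (Icc (0 : ℝ) 1 ∩ γ ⁻¹' F) :=
    isCompact_Icc.inter_right (h.isClosed.preimage hK.continuous)
  have hs := hc.sInf_mem hne
  have ht := hc.sSup_mem hne
  have hge := fun x hx => csInf_le hc.bddBelow (a := x) hx
  have hle' := fun x hx => le_csSup hc.bddAbove (a := x) hx
  set s := sInf (Icc (0 : ℝ) 1 ∩ γ ⁻¹' F)
  set t := sSup (Icc (0 : ℝ) 1 ∩ γ ⁻¹' F)
  have h1 := h.pathLen_Icc_le_of_notMem hM hle le_rfl hs.1.2 fun x hx hxF =>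
    hx.2.not_ge (hge x ⟨⟨hx.1.le, hx.2.le.trans hs.1.2⟩, hxF⟩)
  have h2 := h.pathLen_Icc_le_of_mem hM hle hfin hs.1.1 ht.1.2 hs.2 ht.2
  have h3 := h.pathLen_Icc_le_of_notMem hM hle ht.1.1 le_rfl fun x hx hxF =>
    hx.1.not_ge (hle' x ⟨⟨ht.1.1.trans hx.1.le, hx.2.le⟩, hxF⟩)
  have hcover : Icc (0 : ℝ) 1 ⊆ (Icc 0 s ∪ Icc s t) ∪ Icc t 1 := fun x hx => by
    rcases le_total x s with h4 | h4
    · exact Or.inl (Or.inl ⟨hx.1, h4⟩)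
    rcases le_total x t with h5 | h5
    exacts [Or.inl (Or.inr ⟨h4, h5⟩), Or.inr ⟨h5, hx.2⟩]
  refine (measure_mono hcover).trans ((measure_union_le _ _).trans
    ((add_le_add ((measure_union_le _ _).trans (add_le_add h1 h2)) h3).trans (le_of_eq ?_)))
  rw [← ENNReal.ofReal_add (by positivity) (by positivity),
    ← ENNReal.ofReal_add (by positivity) (by positivity)]
  congr 1
  ring

lemma le_fdtmConst {m : ℝ} (hm : m ∈ Ioo (0 : ℝ) 1) (hβ : 1 ≤ β) :
    24 * (2 / m) + 96 * (2 / m) ^ 2 * (1248 * (2 / m)) ^ β ≤ fdtmConst m β := by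
  obtain ⟨hm0, hm1⟩ := hm
  have hmβ : 0 < m ^ β := by positivity
  have hpow : m ^ (2 + β) = m ^ 2 * m ^ β := by
    rw [Real.rpow_add hm0, Real.rpow_two]
  have hbig : (1 : ℝ) ≤ (2496 / m) ^ β :=
    Real.one_le_rpow ((one_le_div hm0).2 (by linarith)) (by linarith)
  have h1 : 24 * (2 / m) + 96 * (2 / m) ^ 2 * (1248 * (2 / m)) ^ β ≤
      432 / m ^ 2 * (2496 / m) ^ β := by
    have e1 : 24 * (2 / m) ≤ 48 / m ^ 2 * (2496 / m) ^ β := by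
      have e2 : 24 * (2 / m) ≤ 48 / m ^ 2 := by
        rw [← mul_div_assoc, div_le_div_iff₀ hm0 (by positivity)]
        nlinarith
      exact e2.trans (le_mul_of_one_le_right (by positivity) hbig)
    have e3 : 96 * (2 / m) ^ 2 * (1248 * (2 / m)) ^ β = 384 / m ^ 2 * (2496 / m) ^ β := by
      congr 1
      · ring
      · congr 1
        ring
    rw [e3]
    linarith [show 48 / m ^ 2 * (2496 / m) ^ β + 384 / m ^ 2 * (2496 / m) ^ β =
      432 / m ^ 2 * (2496 / m) ^ β by ring]
  have h2 : 432 / m ^ 2 * (2496 / m) ^ β ≤ 2304 / m ^ 2 * (5280 / m) ^ β := by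
    gcongr <;> norm_num
  have h3 : 2304 / m ^ 2 * (5280 / m) ^ β = 2304 * 165 ^ β / (m ^ 2 * m ^ β) * 32 ^ β := by
    rw [Real.div_rpow (by norm_num) hm0.le, show (5280 : ℝ) = 165 * 32 by norm_num,
      Real.mul_rpow (by norm_num) (by norm_num)]
    field_simp
  have hr : (32 : ℝ) ^ β ≤ (1 + 32 / m) ^ (β + 1) / ((1 + 32 / m) - 1) := by
    have hx : 32 ≤ 32 / m := le_div_self (by norm_num) hm0 hm1.le
    have hx0 : 0 < 32 / m := by positivity
    rw [Real.rpow_add (by positivity), Real.rpow_one, add_sub_cancel_left, le_div_iff₀ hx0]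
    gcongr <;> linarith
  calc _ ≤ 2304 * 165 ^ β / (m ^ 2 * m ^ β) * 32 ^ β := h1.trans (h2.trans h3.le)
    _ ≤ 2 * ((16 * (5 : ℝ) ^ β + 1152 * (165 : ℝ) ^ β) / (m ^ 2 * m ^ β)) *
        ((1 + 32 / m) ^ (β + 1) / ((1 + 32 / m) - 1)) := by
      gcongr
      rw [← mul_div_assoc]
      refine div_le_div_of_nonneg_right ?_ (by positivity)
      linarith [Real.rpow_nonneg (show (0 : ℝ) ≤ 5 by norm_num) β]
    _ = fdtmConst m β := by rw [fdtmConst, hpow, mul_div_assoc]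

lemma IsGeodesic.isFermatPath {m p : ℝ} (hm : m ∈ Ioo (0 : ℝ) 1) (hp : 1 ≤ p) (hβ : 0 ≤ β)
    {μ : Measure (Euc d)} [IsProbabilityMeasure μ] (hF : IsClosed F) {x y : Euc d}
    (h : IsGeodesic m p β μ F x y γ) : IsFermatPath (dtm m p μ) (2 / m) β F γ where
  exponent_nonneg := hβ
  one_le_card := (one_le_div hm.1).2 (by linarith [hm.2])
  nonneg := dtm_nonneg μ hm
  lipschitz_weight := lipschitzWith_dtm μ hm hp
  cover _ hρ := exists_cover_dtm_le μ hm hp hρ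
  isClosed := hF
  lipschitz := h.1.1
  straight := h.1.2.2.2
  cost_le _ _ _ hs hst ht hsF htF hB := h.pathCost_Icc_le hm hp hβ hs hst ht hsF htF hB

lemma le_biSup_of_continuous {f : ℝ → ℝ} (hf : Continuous f) {K : Set ℝ} (hK : IsCompact K) {t : ℝ}
    (ht : t ∈ K) (h0 : ∀ t, 0 ≤ f t) : f t ≤ ⨆ t ∈ K, f t := by
  obtain ⟨B, hB⟩ := hK.bddAbove_image hf.continuousOn
  refine le_ciSup_of_le ⟨B, ?_⟩ t (by simp [ht])
  rintro _ ⟨s, rfl⟩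
  by_cases hs : s ∈ K
  · simpa [hs] using hB (mem_image_of_mem f hs)
  · simpa [hs] using (h0 t).trans (hB (mem_image_of_mem f ht))

end Length

theorem eucLength_geodesic_le {d : ℕ} (m p β : ℝ) (hm : m ∈ Set.Ioo (0 : ℝ) 1) (hp : 1 ≤ p)
    (hβ : 1 ≤ β) (μ : Measure (Euc d)) [IsProbabilityMeasure μ]
    (F : Set (Euc d)) (hF : IsClosed F) (hFne : F.Nonempty) (x y : Euc d)
    (γ : ℝ → Euc d) (hγ : IsGeodesic m p β μ F x y γ) :
    eucLength γ ≤ fdtmConst m β * (⨆ t ∈ Icc (0 : ℝ) 1, dtm m p μ (γ t)) := by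
  obtain ⟨K, hK⟩ := hγ.1.1
  have hle : ∀ t ∈ Icc (0 : ℝ) 1, dtm m p μ (γ t) ≤ ⨆ t ∈ Icc (0 : ℝ) 1, dtm m p μ (γ t) :=
    fun t ht => le_biSup_of_continuous (f := fun t => dtm m p μ (γ t))
      ((lipschitzWith_dtm μ hm hp).continuous.comp hK.continuous) isCompact_Icc ht
      fun t => dtm_nonneg μ hm _
  have hM := (dtm_nonneg μ hm _).trans (hle 0 (by simp))
  have hm0 := hm.1
  have hlen := (hγ.isFermatPath hm hp (by linarith) hF).pathLen_le hM hle
    (finite_setOf_dtm_eq_zero μ hm hp)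
  rw [← ofReal_eucLength hK, ENNReal.ofReal_le_ofReal_iff (by positivity)] at hlen
  exact hlen.trans (mul_le_mul_of_nonneg_right (le_fdtmConst hm hβ) hM)

end
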